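/- arXiv:2211.12429 — 2 statements merged into one kernel-verified Lean document; each statement's English description precedes it below -/
import Mathlib

section
/- Assume (J) has no conjugate points, and let d be the solution of (J) with d(0) = 1 and d'(0) = lim_{t→∞} d_t'(0) (this limit exists). Then d(s) ≠ 0 for every s ∈ ℝ. -/
/-- `f` (with derivative `f'`) is a solution of the scalar Jacobi equation
`(J): f''(s) + κ(s)·f(s) = 0`. -/
def IsJacobiSol (κ f f' : ℝ → ℝ) : Prop :=
  (∀ s : ℝ, HasDerivAt f (f' s) s) ∧ (∀ s : ℝ, HasDerivAt f' (-(κ s * f s)) s)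

/-- `(J)` has no conjugate points: every solution of `(J)` that is not identically
zero vanishes at no more than one point of `ℝ`. -/
def NoConjugatePoints (κ : ℝ → ℝ) : Prop :=
  ∀ f f' : ℝ → ℝ, IsJacobiSol κ f f' → (∃ s : ℝ, f s ≠ 0) →
    ∀ s t : ℝ, f s = 0 → f t = 0 → s = t

lemma jac_sub {κ f f' g g' : ℝ → ℝ} (hf : IsJacobiSol κ f f') (hg : IsJacobiSol κ g g') :
    IsJacobiSol κ (fun x => f x - g x) (fun x => f' x - g' x) := by
  refine ⟨fun s => (hf.1 s).sub (hg.1 s), fun s => ?_⟩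
  refine HasDerivAt.congr_deriv ((hf.2 s).sub (hg.2 s)) ?_
  ring

lemma pos_of_no_zero {f : ℝ → ℝ} (hf : Continuous f) {a b : ℝ} (ha : 0 < f a)
    (h : ∀ x ∈ Set.uIcc a b, f x ≠ 0) : 0 < f b := by
  by_contra hb
  push Not at hb
  have := intermediate_value_uIcc (a := a) (b := b) hf.continuousOn
  obtain ⟨x, hx, hx0⟩ := this (show (0 : ℝ) ∈ _ from Set.mem_uIcc.2 (Or.inr ⟨hb, ha.le⟩))
  exact h x hx hx0

lemma deriv_sign {f : ℝ → ℝ} (hf : Continuous f) {c p : ℝ} (hd : HasDerivAt f c 0)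
    (h0 : f 0 = 0) (hne : ∀ x, x ≠ 0 → f x ≠ 0) (hp : p ≠ 0) (hfp : 0 < f p) :
    0 ≤ p * c := by
  have hF : HasDerivAt (fun r : ℝ => f (r * p)) (c * p) 0 := by
    have h1 : HasDerivAt (fun r : ℝ => r * p) p 0 := by
      simpa using (hasDerivAt_id (0 : ℝ)).mul_const p
    have h2 : HasDerivAt f c ((0 : ℝ) * p) := by simpa using hd
    exact h2.comp (0 : ℝ) h1
  have hpos : ∀ r : ℝ, 0 < r → 0 < f (r * p) := by
    intro r hr
    refine pos_of_no_zero (f := fun r => f (r * p)) (a := 1) (b := r) (by fun_prop)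
      (by simpa using hfp) ?_
    intro x hx
    apply hne
    have : 0 < x := by
      rcases Set.mem_uIcc.1 hx with h | h <;> linarith [h.1]
    exact mul_ne_zero this.ne' hp
  have ht := (hasDerivAt_iff_tendsto_slope.1 hF).mono_left
    (nhdsWithin_mono (0 : ℝ) (show Set.Ioi (0 : ℝ) ⊆ {0}ᶜ from fun x hx => ne_of_gt hx))
  rw [mul_comm]
  refine ge_of_tendsto ht ?_
  filter_upwards [self_mem_nhdsWithin] with x hx
  have hx' : (0 : ℝ) < x := hx
  have := hpos x hx'
  simp only [slope_def_field, zero_mul, h0, sub_zero]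
  positivity

lemma jac_unique {κ g g' h h' : ℝ → ℝ} (hg : IsJacobiSol κ g g') (hh : IsJacobiSol κ h h')
    (g0 : g 0 = 0) (g0' : g' 0 = 0) {r : ℝ} (hr : 0 ≤ r) (hpos : ∀ x ∈ Set.Icc 0 r, h x ≠ 0) :
    g r = 0 := by
  have hW : ∀ x, g' x * h x - g x * h' x = 0 := by
    intro x
    have hder : ∀ x, HasDerivAt (fun x => g' x * h x - g x * h' x) 0 x := by
      intro x
      refine HasDerivAt.congr_deriv (((hg.2 x).mul (hh.1 x)).sub ((hg.1 x).mul (hh.2 x))) ?_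
      ring
    have := is_const_of_deriv_eq_zero (fun x => (hder x).differentiableAt)
      (fun x => (hder x).deriv) x 0
    simpa [g0, g0'] using this
  have hder : ∀ x ∈ Set.Icc 0 r, HasDerivAt (fun x => g x / h x) 0 x := by
    intro x hx
    refine HasDerivAt.congr_deriv ((hg.1 x).div (hh.1 x) (hpos x hx)) ?_
    rw [hW x, zero_div]
  have := constant_of_has_deriv_right_zero (f := fun x => g x / h x) (a := 0) (b := r)
    (fun x hx => (hder x hx).continuousAt.continuousWithinAt)
    (fun x hx => (hder x ⟨hx.1, hx.2.le⟩).hasDerivWithinAt) r ⟨hr, le_rfl⟩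
  simp only [g0, zero_div] at this
  exact (div_eq_zero_iff.1 this).resolve_right (hpos r ⟨hr, le_rfl⟩)

/-- Assume `(J)` has no conjugate points, and let `dd` be the solution
of `(J)` with `dd 0 = 1` and `dd' 0 = lim_{t→∞} d_t'(0)`. Then `dd(s) ≠ 0` for every
`s ∈ ℝ`. -/
theorem d_nonvanishing (κ : ℝ → ℝ) (hκ : Continuous κ)
    (hnc : NoConjugatePoints κ)
    (d d' : ℝ → ℝ → ℝ)
    (hd : ∀ t : ℝ, t ≠ 0 → IsJacobiSol κ (d t) (d' t))
    (hd0 : ∀ t : ℝ, t ≠ 0 → d t 0 = 1)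
    (hdt : ∀ t : ℝ, t ≠ 0 → d t t = 0)
    (L : ℝ) (hL : Filter.Tendsto (fun t => d' t 0) Filter.atTop (nhds L))
    (dd dd' : ℝ → ℝ) (hdd : IsJacobiSol κ dd dd')
    (hdd0 : dd 0 = 1) (hdd'0 : dd' 0 = L) :
    ∀ s : ℝ, dd s ≠ 0 := by
  have hcont : ∀ t, t ≠ 0 → Continuous (d t) := fun t ht =>
    continuous_iff_continuousAt.2 fun x => ((hd t ht).1 x).continuousAt
  have hzero : ∀ t, t ≠ 0 → ∀ x, d t x = 0 → x = t := fun t ht x hx =>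
    hnc _ _ (hd t ht) ⟨0, by rw [hd0 t ht]; exact one_ne_zero⟩ x t hx (hdt t ht)
  have hpos : ∀ t, t ≠ 0 → ∀ s, t ∉ Set.uIcc 0 s → 0 < d t s := by
    intro t ht s hts
    refine pos_of_no_zero (hcont t ht) (a := 0) (by rw [hd0 t ht]; exact one_pos) ?_
    intro x hx h0
    exact hts (hzero t ht x h0 ▸ hx)
  have key : ∀ s t, s ≠ 0 → t ≠ 0 → t ∉ Set.uIcc 0 s → 0 ≤ s * (d' t 0 - d' s 0) := by
    intro s t hs ht hts
    have hg := jac_sub (hd t ht) (hd s hs)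
    have hgs : 0 < d t s - d s s := by rw [hdt s hs, sub_zero]; exact hpos t ht s hts
    have hg0 : d t 0 - d s 0 = 0 := by rw [hd0 t ht, hd0 s hs, sub_self]
    exact deriv_sign (f := fun x => d t x - d s x) ((hcont t ht).sub (hcont s hs)) (hg.1 0) hg0
      (fun x hx h0 => hx (hnc _ _ hg ⟨s, hgs.ne'⟩ x 0 h0 hg0)) hs hgs
  have strict : ∀ s t, s ≠ 0 → t ≠ 0 → s ≠ t → d' t 0 ≠ d' s 0 := by
    intro s t hs ht hst h
    have hg := jac_sub (hd t ht) (hd s hs)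
    have hg0 : d t 0 - d s 0 = 0 := by rw [hd0 t ht, hd0 s hs, sub_self]
    have h1 := jac_unique hg (hd (-1) (by norm_num)) hg0 (by simp [h]) (r := 1) zero_le_one (by
      intro x hx h0
      have := hzero (-1) (by norm_num) x h0
      linarith [hx.1])
    have hgs : d t s - d s s ≠ 0 := by
      rw [hdt s hs, sub_zero]
      exact fun h0 => hst (hzero t ht s h0)
    have := hnc _ _ hg ⟨s, hgs⟩ 1 0 h1 hg0
    exact one_ne_zero this
  intro s hs0
  have hs : s ≠ 0 := by
    rintro rfl
    rw [hdd0] at hs0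
    exact one_ne_zero hs0
  -- `dd` and `d s` agree identically
  have hg := jac_sub hdd (hd s hs)
  have heq : ∀ x, dd x - d s x = 0 := by
    intro x
    by_contra hx
    exact hs (hnc _ _ hg ⟨x, hx⟩ s 0 (by simp [hs0, hdt s hs]) (by simp [hdd0, hd0 s hs]))
  have hLs : L = d' s 0 := by
    have h1 := hg.1 0
    have h2 : HasDerivAt (fun x => dd x - d s x) 0 0 := by
      rw [funext heq]; exact hasDerivAt_const _ _
    have := h1.unique h2
    linarith
  rcases lt_or_gt_of_ne hs with hneg | hpos'
  · have hs' : s - 1 ≠ 0 := by intro h; linarith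
    have h1 : L ≤ d' (s - 1) 0 := by
      refine le_of_tendsto hL ?_
      filter_upwards [Filter.eventually_gt_atTop 0] with t ht
      have := key (s - 1) t hs' ht.ne' (by
        rw [Set.uIcc_of_ge (by linarith)]; exact fun h => by linarith [h.2])
      nlinarith
    have h2 := key s (s - 1) hs hs' (by
        rw [Set.uIcc_of_ge (by linarith)]; exact fun h => by linarith [h.1])
    have h3 : d' (s - 1) 0 ≤ d' s 0 := by nlinarith
    exact strict s (s - 1) hs hs' (by intro h; linarith) (by linarith)
  · have hs' : s + 1 ≠ 0 := by intro h; linarith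
    have h1 : d' (s + 1) 0 ≤ L := by
      refine ge_of_tendsto hL ?_
      filter_upwards [Filter.eventually_gt_atTop (s + 1)] with t ht
      have := key (s + 1) t hs' (by intro h; linarith) (by
        rw [Set.uIcc_of_le (by linarith)]; exact fun h => by linarith [h.2])
      nlinarith
    have h2 := key s (s + 1) hs hs' (by
        rw [Set.uIcc_of_le (by linarith)]; exact fun h => by linarith [h.2])
    have h3 : d' s 0 ≤ d' (s + 1) 0 := by nlinarith
    exact strict s (s + 1) hs hs' (by intro h; linarith) (by linarith)
end

section
/- Assume (J) has no conjugate points and that there exists k > 0 with κ(s) > −k² for all s ∈ ℝ. Then for every R > 0 there exists T > 0 such that every solution f of (J) with f(0) = 0 satisfies |f(s)| ≥ R·|f'(0)| for all s ≥ T. In particular, a(s) → ∞ as s → ∞. -/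
open Set Filter Topology

lemma jac_wronskian {κ f f' g g' : ℝ → ℝ} (hf : IsJacobiSol κ f f') (hg : IsJacobiSol κ g g')
    (s : ℝ) : f s * g' s - f' s * g s = f 0 * g' 0 - f' 0 * g 0 := by
  have h : ∀ t, HasDerivAt (fun t => f t * g' t - f' t * g t) 0 t := by
    intro t
    refine HasDerivAt.congr_deriv (((hf.1 t).mul (hg.2 t)).sub ((hf.2 t).mul (hg.1 t))) ?_
    ring
  exact is_const_of_deriv_eq_zero (fun t => (h t).differentiableAt) (fun t => (h t).deriv) s 0

lemma jac_comb {κ f f' g g' : ℝ → ℝ} (hf : IsJacobiSol κ f f') (hg : IsJacobiSol κ g g')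
    (m : ℝ) : IsJacobiSol κ (fun s => f s - m * g s) (fun s => f' s - m * g' s) := by
  refine ⟨fun s => (hf.1 s).sub ((hg.1 s).const_mul m), fun s => ?_⟩
  refine HasDerivAt.congr_deriv ((hf.2 s).sub ((hg.2 s).const_mul m)) ?_
  ring

/-- A second global solution, by the Rofe-Beketov formula. -/
lemma jac_second {κ a a' : ℝ → ℝ} (hκ : Continuous κ) (ha : IsJacobiSol κ a a')
    (ha0 : a 0 = 0) (ha'0 : a' 0 = 1) (hE : ∀ s, a s ^ 2 + a' s ^ 2 ≠ 0) :
    ∃ b b' : ℝ → ℝ, IsJacobiSol κ b b' ∧ b 0 = 1 ∧ b' 0 = 0 := by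
  have ca : Continuous a := continuous_iff_continuousAt.2 fun s => (ha.1 s).continuousAt
  have ca' : Continuous a' := continuous_iff_continuousAt.2 fun s => (ha.2 s).continuousAt
  set g : ℝ → ℝ := fun s => (1 - κ s) * (a' s ^ 2 - a s ^ 2) / (a s ^ 2 + a' s ^ 2) ^ 2 with hg
  have cg : Continuous g := by
    refine Continuous.div (by fun_prop) (by fun_prop) fun s => pow_ne_zero 2 (hE s)
  set I : ℝ → ℝ := fun s => ∫ t in (0:ℝ)..s, g t with hI
  have dI : ∀ s, HasDerivAt I (g s) s := fun s => (cg.integral_hasStrictDerivAt 0 s).hasDerivAt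
  have I0 : I 0 = 0 := by simp [hI]
  have dE : ∀ s, HasDerivAt (fun s => a s ^ 2 + a' s ^ 2)
      (2 * a s * a' s + 2 * a' s * (-(κ s * a s))) s := by
    intro s
    refine HasDerivAt.congr_deriv (((ha.1 s).pow 2).add ((ha.2 s).pow 2)) ?_
    norm_num
  refine ⟨fun s => a' s / (a s ^ 2 + a' s ^ 2) + a s * I s,
    fun s => -(a s / (a s ^ 2 + a' s ^ 2)) + a' s * I s, ⟨fun s => ?_, fun s => ?_⟩, ?_, ?_⟩
  · refine HasDerivAt.congr_deriv (((ha.2 s).div (dE s) (hE s)).add ((ha.1 s).mul (dI s))) ?_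
    have := hE s
    simp only [hg]
    field_simp
    ring
  · refine HasDerivAt.congr_deriv (((ha.1 s).div (dE s) (hE s)).neg.add ((ha.2 s).mul (dI s))) ?_
    have := hE s
    simp only [hg]
    field_simp
    ring
  · simp [ha0, ha'0]
  · simp [ha0, I0]

lemma jac_pos_of_ne {f : ℝ → ℝ} (hf : Continuous f) {x : ℝ} (hx : 0 < f x)
    (h : ∀ s, x ≤ s → f s ≠ 0) (s : ℝ) (hs : x ≤ s) : 0 < f s := by
  by_contra hn
  push Not at hn
  obtain ⟨t, ht, h0⟩ := intermediate_value_Icc' hs hf.continuousOn ⟨hn, hx.le⟩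
  exact h t ht.1 h0

lemma jac_pos {a a' : ℝ → ℝ} (hd : ∀ s, HasDerivAt a (a' s) s) (ha0 : a 0 = 0)
    (ha'0 : a' 0 = 1) (hne : ∀ s, a s = 0 → s = 0) (s : ℝ) (hs : 0 < s) : 0 < a s := by
  have ca : Continuous a := continuous_iff_continuousAt.2 fun s => (hd s).continuousAt
  have h := (hd 0).tendsto_slope_zero_right
  rw [ha'0] at h
  have h1 := (h.eventually (lt_mem_nhds (zero_lt_one))).and
    (Ioo_mem_nhdsGT hs)
  obtain ⟨t, ht, ht0, hts⟩ := h1.exists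
  simp only [zero_add, ha0, sub_zero, smul_eq_mul] at ht
  have hat : 0 < a t := by
    by_contra hn
    have : t⁻¹ * a t ≤ 0 := mul_nonpos_of_nonneg_of_nonpos (inv_nonneg.2 ht0.le) (not_lt.1 hn)
    linarith
  exact jac_pos_of_ne ca hat (fun u hu h0 => by have := hne u h0; linarith) s hts.le

/-- Comparison with sinh. -/
lemma jac_growth_bound {κ a a' : ℝ → ℝ} {k : ℝ} (hk : 0 < k) (hκk : ∀ s : ℝ, -k ^ 2 < κ s)
    (ha : IsJacobiSol κ a a') (ha0 : a 0 = 0) (hpos : ∀ s, 0 < s → 0 < a s)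
    {s t : ℝ} (hs : 1 ≤ s) (hst : s ≤ t) (ht : t ≤ s + 1) :
    a t ≤ 2 * Real.cosh k * a s := by
  have dsh : ∀ u, HasDerivAt (fun u => Real.sinh (k * u)) (Real.cosh (k * u) * k) u := by
    intro u
    simpa using ((hasDerivAt_id u).const_mul k).sinh
  have dch : ∀ u, HasDerivAt (fun u => Real.cosh (k * u)) (Real.sinh (k * u) * k) u := by
    intro u
    simpa using ((hasDerivAt_id u).const_mul k).cosh
  have dW : ∀ u, HasDerivAt (fun u => a' u * Real.sinh (k * u) - a u * (k * Real.cosh (k * u)))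
      (-((κ u + k ^ 2) * (a u * Real.sinh (k * u)))) u := by
    intro u
    refine HasDerivAt.congr_deriv (((ha.2 u).mul (dsh u)).sub ((ha.1 u).mul ((dch u).const_mul k))) ?_
    ring
  have hW : ∀ u, 0 ≤ u → a' u * Real.sinh (k * u) - a u * (k * Real.cosh (k * u)) ≤ 0 := by
    intro u hu
    have anti : AntitoneOn (fun u => a' u * Real.sinh (k * u) - a u * (k * Real.cosh (k * u)))
        (Ici 0) := by
      refine antitoneOn_of_hasDerivWithinAt_nonpos (convex_Ici 0)
        (fun u _ => (dW u).continuousAt.continuousWithinAt)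
        (fun u _ => (dW u).hasDerivWithinAt) ?_
      intro u hu
      rw [interior_Ici] at hu
      have h1 : 0 < κ u + k ^ 2 := by linarith [hκk u]
      have h2 := hpos u hu
      have h3 : 0 < Real.sinh (k * u) := Real.sinh_pos_iff.2 (mul_pos hk hu)
      have : 0 < (κ u + k ^ 2) * (a u * Real.sinh (k * u)) := by positivity
      linarith
    have := anti (mem_Ici.2 le_rfl) hu hu
    simpa [ha0] using this
  have shpos : ∀ u, 0 < u → 0 < Real.sinh (k * u) := fun u hu =>
    Real.sinh_pos_iff.2 (mul_pos hk hu)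
  have anti : AntitoneOn (fun u => a u / Real.sinh (k * u)) (Ioi 0) := by
    have dq : ∀ u, 0 < u → HasDerivAt (fun u => a u / Real.sinh (k * u)) _ u :=
      fun u hu => (ha.1 u).div (dsh u) (shpos u hu).ne'
    refine antitoneOn_of_hasDerivWithinAt_nonpos (convex_Ioi 0)
      (fun u hu => (dq u hu).continuousAt.continuousWithinAt)
      (fun u hu => (dq u (by simpa using hu)).hasDerivWithinAt) ?_
    intro u hu
    rw [interior_Ioi] at hu
    refine div_nonpos_of_nonpos_of_nonneg ?_ (by positivity)
    have := hW u (le_of_lt hu)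
    linarith
  have s0 : 0 < s := by linarith
  have t0 : 0 < t := by linarith
  have h1 : a t / Real.sinh (k * t) ≤ a s / Real.sinh (k * s) := anti s0 t0 hst
  rw [div_le_div_iff₀ (shpos t t0) (shpos s s0)] at h1
  have h2 : Real.sinh (k * t) ≤ 2 * Real.cosh k * Real.sinh (k * s) := by
    have e1 : Real.sinh (k * t) ≤ Real.sinh (k * s + k) := by
      apply Real.sinh_le_sinh.2
      nlinarith
    have e2 : 0 ≤ Real.sinh (k * s - k) := Real.sinh_nonneg_iff.2 (by nlinarith)
    rw [Real.sinh_add] at e1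
    rw [Real.sinh_sub] at e2
    linarith
  have h3 := mul_le_mul_of_nonneg_left h2 (hpos s s0).le
  have h4 : a t * Real.sinh (k * s) ≤ (2 * Real.cosh k * a s) * Real.sinh (k * s) := by
    linarith
  exact le_of_mul_le_mul_right h4 (shpos s s0)

/-- Assume `(J)` has no conjugate points and `κ s > −k²` for all `s`,
where `k > 0`. Then for every `R > 0` there exists `T > 0` such that every solution `f`
of `(J)` with `f 0 = 0` satisfies `|f s| ≥ R·|f' 0|` for all `s ≥ T`. In particular,
`a s → ∞` as `s → ∞`, where `a` is the solution with `a 0 = 0`, `a' 0 = 1`. -/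
theorem jacobi_growth (κ : ℝ → ℝ) (hκ : Continuous κ)
    (hnc : NoConjugatePoints κ)
    (k : ℝ) (hk : 0 < k) (hκk : ∀ s : ℝ, -k ^ 2 < κ s)
    (a a' : ℝ → ℝ) (ha : IsJacobiSol κ a a') (ha0 : a 0 = 0) (ha'0 : a' 0 = 1) :
    (∀ R : ℝ, 0 < R → ∃ T : ℝ, 0 < T ∧
      ∀ f f' : ℝ → ℝ, IsJacobiSol κ f f' → f 0 = 0 →
        ∀ s : ℝ, T ≤ s → R * |f' 0| ≤ |f s|) ∧
    Filter.Tendsto a Filter.atTop Filter.atTop := by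
  have hne : ∀ s, a s = 0 → s = 0 := by
    refine fun s hs => hnc a a' ha ?_ s 0 hs ha0
    by_contra hn
    push Not at hn
    have h1 : a = fun _ => 0 := funext hn
    have h2 := (ha.1 0).unique (h1 ▸ hasDerivAt_const (0:ℝ) (0:ℝ))
    linarith
  have hE : ∀ s, a s ^ 2 + a' s ^ 2 ≠ 0 := by
    intro s hs
    have h1 : a s = 0 := by nlinarith [sq_nonneg (a s), sq_nonneg (a' s)]
    have h2 : a' s = 0 := by nlinarith [sq_nonneg (a s), sq_nonneg (a' s)]
    rw [hne s h1] at h2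
    linarith
  have hpos := jac_pos ha.1 ha0 ha'0 hne
  obtain ⟨b, b', hb, hb0, hb'0⟩ := jac_second hκ ha ha0 ha'0 hE
  have ham : a (-1) ≠ 0 := fun h => by have := hne _ h; norm_num at this
  have hc := jac_comb hb ha (b (-1) / a (-1))
  set c : ℝ → ℝ := fun s => b s - b (-1) / a (-1) * a s with hcdef
  set c' : ℝ → ℝ := fun s => b' s - b (-1) / a (-1) * a' s with hcdef'
  have c0 : c 0 = 1 := by simp [hcdef, ha0, hb0]
  have cm : c (-1) = 0 := by simp only [hcdef]; field_simp; ring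
  have cc : Continuous c := continuous_iff_continuousAt.2 fun s => (hc.1 s).continuousAt
  have cpos : ∀ s, 0 ≤ s → 0 < c s := by
    refine jac_pos_of_ne cc (by rw [c0]; norm_num) fun s hs h => ?_
    have := hnc c c' hc ⟨0, by rw [c0]; norm_num⟩ s (-1) h cm
    linarith
  have dq : ∀ s, 0 < s → HasDerivAt (fun s => c s / a s) (-1 / a s ^ 2) s := by
    intro s hs
    refine HasDerivAt.congr_deriv ((hc.1 s).div (ha.1 s) (hpos s hs).ne') ?_
    have := jac_wronskian hc ha s
    rw [c0, ha0, ha'0] at this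
    congr 1
    linarith
  have qpos : ∀ s, 0 < s → 0 < c s / a s := fun s hs => div_pos (cpos s hs.le) (hpos s hs)
  have qanti : AntitoneOn (fun s => c s / a s) (Ioi 0) := by
    refine antitoneOn_of_hasDerivWithinAt_nonpos (convex_Ioi 0)
      (fun u hu => (dq u hu).continuousAt.continuousWithinAt)
      (fun u hu => (dq u (by simpa using hu)).hasDerivWithinAt) ?_
    intro u hu
    exact div_nonpos_of_nonpos_of_nonneg (by norm_num) (sq_nonneg _)
  -- eventually large
  have key : ∀ R : ℝ, 0 < R → ∃ T : ℝ, 0 < T ∧ ∀ s, T ≤ s → R ≤ a s := by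
    intro R hR
    set C := 2 * Real.cosh k * R with hC
    have hCpos : 0 < C := by have := Real.cosh_pos k; positivity
    have step : ∀ s, 1 ≤ s → a s < R → c (s + 1) / a (s + 1) ≤ c s / a s - 1 / C ^ 2 := by
      intro s hs has
      obtain ⟨ξ, hξ, he⟩ := exists_hasDerivAt_eq_slope (fun s => c s / a s) (fun s => -1 / a s ^ 2)
        (show s < s + 1 by linarith)
        (fun u hu => (dq u (by linarith [hu.1])).continuousAt.continuousWithinAt)
        (fun u hu => dq u (by linarith [hu.1]))
      have hb1 := jac_growth_bound hk hκk ha ha0 hpos hs hξ.1.le hξ.2.le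
      have hp := hpos ξ (by linarith [hξ.1])
      have hb2 : a ξ ≤ C := by
        have := Real.cosh_pos k
        refine hb1.trans ?_
        rw [hC]
        gcongr
      have : 1 / C ^ 2 ≤ 1 / a ξ ^ 2 := by gcongr
      simp only [add_sub_cancel_left, div_one, neg_div] at he
      linarith
    by_contra hn
    push Not at hn
    have ind : ∀ n : ℕ, ∃ s, 1 ≤ s ∧ c s / a s ≤ c 1 / a 1 - n * (1 / C ^ 2) := by
      intro n
      induction n with
      | zero => exact ⟨1, le_rfl, by simp⟩
      | succ n ih =>
        obtain ⟨s, hs, hle⟩ := ih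
        obtain ⟨t, hst, hat⟩ := hn s (by linarith)
        refine ⟨t + 1, by linarith, ?_⟩
        have h1 := step t (by linarith) hat
        have h2 : c t / a t ≤ c s / a s :=
          qanti (show 0 < s by linarith) (show 0 < t by linarith) hst
        push_cast
        linarith
    obtain ⟨n, hn'⟩ := exists_nat_gt ((c 1 / a 1) / (1 / C ^ 2))
    obtain ⟨s, hs, hle⟩ := ind n
    have := qpos s (by linarith)
    rw [div_lt_iff₀ (by positivity)] at hn'
    linarith
  constructor
  · intro R hR
    obtain ⟨T, hT, h⟩ := key R hR
    refine ⟨T, hT, fun f f' hf hf0 s hs => ?_⟩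
    have hfa : f s = f' 0 * a s := by
      have w1 := jac_wronskian hf ha s
      have w2 := jac_wronskian hf hb s
      have w3 := jac_wronskian hb ha s
      rw [hf0, ha0] at w1
      rw [hf0, hb0] at w2
      rw [hb0, ha0, ha'0] at w3
      linear_combination (-f s) * w3 + b s * w1 - a s * w2
    rw [hfa, abs_mul, mul_comm]
    exact mul_le_mul_of_nonneg_left ((h s hs).trans (le_abs_self _)) (abs_nonneg _)
  · refine tendsto_atTop.2 fun R => ?_
    obtain ⟨T, -, h⟩ := key (max R 1) (by positivity)
    filter_upwards [eventually_ge_atTop T] with s hs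
    exact (le_max_left _ _).trans (h s hs)
end
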